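/- Let A be a regular local ring with maximal ideal m and residue field k, let f_1,…,f_r ∈ m be elements whose images in m/m² are linearly independent over k (i.e., f_1,…,f_r form part of a regular system of parameters), and let n be a positive integer invertible in A. Set B_n' = A[T_1,…,T_r]/(T_1^{n} − f_1, …, T_r^{n} − f_r) and let B_n be the localization of B_n' at the multiplicative set generated by the class of T_1⋯T_r. Then the Picard group of B_n is trivial: every invertible B_n-module is free of rank one. -/

import Mathlib

open MvPolynomial

/-- `B_n' = A[T₁,…,T_r]/(T₁ⁿ − f₁, …, T_rⁿ − f_r)`. -/
abbrev kummerQuot {A : Type*} [CommRing A] {r : ℕ} (f : Fin r → A) (n : ℕ) : Type _ :=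
  MvPolynomial (Fin r) A ⧸
    Ideal.span (Set.range fun i : Fin r => (X i : MvPolynomial (Fin r) A) ^ n - C (f i))

/-- `B_n`, the localization of `B_n'` at the multiplicative set generated by the class of
`T₁ ⋯ T_r`. -/
abbrev kummerLoc {A : Type*} [CommRing A] {r : ℕ} (f : Fin r → A) (n : ℕ) : Type _ :=
  Localization.Away
    (Ideal.Quotient.mk _ (∏ i : Fin r, (X i : MvPolynomial (Fin r) A)) : kummerQuot f n)

open IsLocalRing in
/-- A family in the maximal ideal which is linearly independent in the cotangent space extends to a
minimal system of generators. -/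
lemma exists_finset_span_union_eq_maximalIdeal {A ι : Type*} [CommRing A] [IsLocalRing A]
    [IsNoetherianRing A] [Fintype ι] (f : ι → A) (hf : ∀ i, f i ∈ maximalIdeal A)
    (hind : LinearIndependent (ResidueField A)
      (fun i => (maximalIdeal A).toCotangent ⟨f i, hf i⟩)) :
    ∃ t : Finset A, Fintype.card ι + t.card ≤ (maximalIdeal A).spanFinrank ∧
      Ideal.span (Set.range f ∪ t) = maximalIdeal A := by
  classical
  rw [spanFinrank_maximalIdeal_eq_finrank_cotangentSpace]
  set b : Module.Basis _ (ResidueField A) (CotangentSpace A) := Module.Basis.sumExtend hind with hb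
  have : Finite (ι ⊕ Module.Basis.sumExtendIndex hind) := Module.Finite.finite_basis b
  have : Finite (Module.Basis.sumExtendIndex hind) := Finite.sum_right ι
  have := Fintype.ofFinite (Module.Basis.sumExtendIndex hind)
  choose g hg using fun i => (maximalIdeal A).toCotangent_surjective (b (Sum.inr i))
  have hbl : ∀ i, b (Sum.inl i) = (maximalIdeal A).toCotangent ⟨f i, hf i⟩ := fun i => by
    simp [hb, Module.Basis.sumExtend]
    rfl
  let s : Set (maximalIdeal A) := Set.range (fun i => ⟨f i, hf i⟩) ∪ Set.range g
  have hs : Submodule.span A s = ⊤ := by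
    rw [← CotangentSpace.span_image_eq_top_iff, ← b.span_eq]
    congr 1
    rw [Set.image_union, ← Set.range_comp, ← Set.range_comp, ← Set.Sum.elim_range]
    congr 1
    ext (i | i)
    · exact (hbl i).symm
    · exact hg i
  refine ⟨Finset.univ.image (fun i => (g i : A)), ?_, ?_⟩
  · rw [Module.finrank_eq_card_basis b, Fintype.card_sum]
    gcongr
    exact Finset.card_image_le
  · have := congrArg (Submodule.map (maximalIdeal A).subtype) hs
    rw [Submodule.map_span, Submodule.map_top, Submodule.range_subtype, Set.image_union,
      ← Set.range_comp, ← Set.range_comp] at this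
    simpa using! this

open IsLocalRing in
lemma IsLocalRing.exists_finset_span_insert_eq_maximalIdeal {A : Type*} [CommRing A] [IsLocalRing A]
    [IsNoetherianRing A] {x : A} (hx : x ∈ maximalIdeal A) (hx2 : x ∉ maximalIdeal A ^ 2) :
    ∃ t : Finset A, 1 + t.card ≤ (maximalIdeal A).spanFinrank ∧
      Ideal.span (insert x (t : Set A)) = maximalIdeal A := by
  have := exists_finset_span_union_eq_maximalIdeal (fun _ : Unit => x) (fun _ => hx)
    (LinearIndependent.of_subsingleton () (by
      simpa [Ideal.toCotangent_eq_zero] using! hx2))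
  rwa [Set.range_const, Fintype.card_unit] at this

open IsLocalRing in
/-- The quotient of a regular local ring by a parameter outside `m²` is regular. -/
lemma IsRegularLocalRing.quotient_span_singleton {A : Type*} [CommRing A] [IsRegularLocalRing A]
    {x : A} (hx : x ∈ maximalIdeal A) (hx2 : x ∉ maximalIdeal A ^ 2) :
    IsRegularLocalRing (A ⧸ Ideal.span {x}) ∧
      ringKrullDim A = ringKrullDim (A ⧸ Ideal.span {x}) + 1 := by
  obtain ⟨t, ht, hspan⟩ := exists_finset_span_insert_eq_maximalIdeal hx hx2
  have hne : Ideal.span {x} ≠ ⊤ := ne_top_of_le_ne_top (maximalIdeal.isMaximal A).ne_top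
    ((Ideal.span_singleton_le_iff_mem _).mpr hx)
  have := Ideal.Quotient.nontrivial_iff.mpr hne
  have hloc : IsLocalRing (A ⧸ Ideal.span {x}) :=
    .of_surjective' _ Ideal.Quotient.mk_surjective
  have hmax : maximalIdeal (A ⧸ Ideal.span {x}) =
      Ideal.span (Ideal.Quotient.mk (Ideal.span {x}) '' t) := by
    rw [← map_maximalIdeal_of_surjective _ Ideal.Quotient.mk_surjective, ← hspan, Ideal.map_span,
      Set.image_insert_eq]
    simp
  have h1 : (maximalIdeal (A ⧸ Ideal.span {x})).spanFinrank ≤ t.card := by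
    rw [hmax, ← Set.ncard_coe_finset]
    exact (Submodule.spanFinrank_span_le_ncard_of_finite (t.finite_toSet.image _)).trans
      (Set.ncard_image_le t.finite_toSet)
  have h2 : ringKrullDim A ≤ ringKrullDim (A ⧸ Ideal.span {x}) + 1 := by
    have := ringKrullDim_le_ringKrullDim_quotient_add_card {x} (R := A)
      (by simpa [IsLocalRing.ringJacobson_eq_maximalIdeal])
    rwa [Finset.coe_singleton, Finset.card_singleton, Nat.cast_one] at this
  have h3 := ringKrullDim_le_spanFinrank_maximalIdeal (A ⧸ Ideal.span {x})
  have h4 := IsRegularLocalRing.spanFinrank_maximalIdeal (R := A)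
  have h5 : ((1 + t.card : ℕ) : WithBot ℕ∞) ≤ ringKrullDim A := by
    rw [← h4]; exact_mod_cast ht
  have hr : IsRegularLocalRing (A ⧸ Ideal.span {x}) := by
    refine .of_spanFinrank_maximalIdeal_le _ ?_
    have h6 : ((t.card : ℕ) : WithBot ℕ∞) ≤ ringKrullDim (A ⧸ Ideal.span {x}) := by
      have := h5.trans h2
      rw [add_comm] at this
      push_cast at this
      exact ENat.WithBot.add_le_add_one_right_iff.mp this
    exact le_trans (by exact_mod_cast h1) h6
  refine ⟨hr, h2.antisymm ?_⟩
  refine le_trans ?_ h5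
  rw [← hr.spanFinrank_maximalIdeal]
  have : (maximalIdeal (A ⧸ Ideal.span {x})).spanFinrank + 1 ≤ 1 + t.card := by omega
  exact_mod_cast this

/-- A Noetherian local ring of positive dimension has an element of `m \ m²` outside all
minimal primes. -/
lemma IsLocalRing.exists_mem_maximalIdeal_notMem_sq {A : Type*} [CommRing A]
    [IsLocalRing A] [IsNoetherianRing A] (hd : ringKrullDim A ≠ 0) :
    ∃ x ∈ maximalIdeal A, x ∉ maximalIdeal A ^ 2 ∧ ∀ p ∈ minimalPrimes A, x ∉ p := by
  classical
  by_contra! H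
  have hfin := minimalPrimes.finite_of_isNoetherianRing A
  have hsub : ((maximalIdeal A : Ideal A) : Set A) ⊆
      ⋃ i ∈ ((insert (maximalIdeal A ^ 2) hfin.toFinset : Finset (Ideal A)) : Set (Ideal A)),
        (i : Set A) := by
    intro x hx
    by_cases hx2 : x ∈ maximalIdeal A ^ 2
    · simp [hx2]
    · obtain ⟨p, hp, hxp⟩ := H x hx hx2
      simp only [Set.mem_iUnion]
      exact ⟨p, by simp [hp], hxp⟩
  rw [Ideal.subset_union_prime (maximalIdeal A ^ 2) (maximalIdeal A ^ 2)] at hsub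
  · obtain ⟨p, hp, hle⟩ := hsub
    rw [Finset.mem_insert, Set.Finite.mem_toFinset] at hp
    obtain rfl | hp := hp
    · exact (maximalIdeal_sq_lt_of_ringKrullDim_ne_zero hd).not_ge hle
    · have hpp : p.IsPrime := hp.1.1
      have : p = maximalIdeal A := le_antisymm (le_maximalIdeal hpp.ne_top) hle
      apply hd
      rw [← maximalIdeal_height_eq_ringKrullDim, ← this, Ideal.height_eq_zero_iff.mpr hp]
      rfl
  · intro i hi h1 _
    rw [Finset.mem_insert, Set.Finite.mem_toFinset] at hi
    exact (hi.resolve_left h1).1.1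

/-- A regular local ring is a domain. -/
theorem IsRegularLocalRing.isDomain {A : Type*} [CommRing A] [IsRegularLocalRing A] :
    IsDomain A := by
  have hA := (inferInstance : IsRegularLocalRing A).spanFinrank_maximalIdeal
  generalize hd : (IsLocalRing.maximalIdeal A).spanFinrank = d at hA
  induction d generalizing A with
  | zero =>
    have hbot : IsLocalRing.maximalIdeal A = ⊥ :=
      (Submodule.spanFinrank_eq_zero_iff_eq_bot
        (IsLocalRing.maximalIdeal A).fg_of_isNoetherianRing).mp hd
    exact (IsLocalRing.isField_iff_maximalIdeal_eq.mpr hbot).isDomain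
  | succ d ih =>
    obtain ⟨x, hx, hx2, hxp⟩ := IsLocalRing.exists_mem_maximalIdeal_notMem_sq (A := A)
      (by rw [← hA]; exact_mod_cast d.succ_ne_zero)
    obtain ⟨hreg, hdim⟩ := quotient_span_singleton hx hx2
    have hdim' : ringKrullDim (A ⧸ Ideal.span {x}) = d := by
      rw [← hA] at hdim
      push_cast at hdim
      exact le_antisymm (ENat.WithBot.add_le_add_one_right_iff.mp hdim.ge)
        (ENat.WithBot.add_le_add_one_right_iff.mp hdim.le)
    have := ih (by exact_mod_cast hreg.spanFinrank_maximalIdeal.trans hdim') hdim'.symm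
    have hprime : (Ideal.span {x}).IsPrime := (Ideal.Quotient.isDomain_iff_prime _).mp this
    obtain ⟨p, hp, hple⟩ := Ideal.exists_minimalPrimes_le (bot_le (a := Ideal.span {x}))
    have hpp : p.IsPrime := hp.1.1
    have hpbot : p = ⊥ := by
      refine Submodule.eq_bot_of_le_smul_of_le_jacobson_bot (Ideal.span {x}) p
        p.fg_of_isNoetherianRing (fun y hy => ?_) ?_
      · obtain ⟨z, rfl⟩ := Ideal.mem_span_singleton.mp (hple hy)
        exact Submodule.smul_mem_smul (Ideal.mem_span_singleton_self x)
          ((hpp.mem_or_mem hy).resolve_left (hxp p hp))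
      · rw [IsLocalRing.jacobson_eq_maximalIdeal _ bot_ne_top]
        exact (Ideal.span_singleton_le_iff_mem _).mpr hx
    subst hpbot
    exact IsDomain.of_bot_isPrime A

/-- `HasFreeResolution R n M`: the `R`-module `M` has a resolution of length at most `n` by finite
free `R`-modules. -/
def HasFreeResolution (R : Type*) [CommRing R] :
    ℕ → ∀ (M : Type _) [AddCommGroup M] [Module R M], Prop
  | 0, M, _, _ => Module.Finite R M ∧ Module.Free R M
  | n + 1, M, _, _ => ∃ (k : ℕ) (f : (Fin k → R) →ₗ[R] M), Function.Surjective f ∧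
      HasFreeResolution R n (LinearMap.ker f)

namespace HasFreeResolution

open TensorProduct

universe u

lemma of_linearEquiv {R : Type u} [CommRing R] {n : ℕ} {M N : Type u} [AddCommGroup M] [Module R M]
    [AddCommGroup N] [Module R N] (e : M ≃ₗ[R] N) (h : HasFreeResolution R n M) :
    HasFreeResolution R n N := by
  cases n with
  | zero =>
    obtain ⟨_, _⟩ := h
    exact ⟨Module.Finite.equiv e, Module.Free.of_equiv e⟩
  | succ n =>
    obtain ⟨k, f, hf, h⟩ := h
    refine ⟨k, e.toLinearMap ∘ₗ f, e.surjective.comp hf, ?_⟩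
    rwa [LinearEquiv.ker_comp]

/-- Free resolutions base change along flat ring homomorphisms. -/
lemma baseChange {R S : Type u} [CommRing R] [CommRing S] [Algebra R S] [Module.Flat R S] {n : ℕ}
    {M : Type u} [AddCommGroup M] [Module R M] (h : HasFreeResolution R n M) :
    HasFreeResolution S n (S ⊗[R] M) := by
  induction n generalizing M with
  | zero =>
    obtain ⟨_, _⟩ := h
    exact ⟨inferInstance, inferInstance⟩
  | succ n ih =>
    obtain ⟨k, f, hf, h⟩ := h
    let e : S ⊗[R] (Fin k → R) ≃ₗ[S] (Fin k → S) := TensorProduct.piScalarRight R S S (Fin k)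
    let g : S ⊗[R] (Fin k → R) →ₗ[S] S ⊗[R] M := TensorProduct.AlgebraTensorModule.lTensor S S f
    have hg : Function.Surjective g := LinearMap.lTensor_surjective S hf
    refine ⟨k, g ∘ₗ e.symm.toLinearMap, hg.comp e.symm.surjective, ?_⟩
    refine of_linearEquiv ?_ (ih h)
    refine (LinearMap.tensorKerEquiv S S f).trans (e.submoduleMap _ |>.trans (.ofEq _ _ ?_))
    ext x
    simp [g, Submodule.mem_map_equiv]

/-- A projective module with a finite free resolution is stably free. -/
lemma isStablyFree {R : Type u} [CommRing R] {n : ℕ} {M : Type u} [AddCommGroup M] [Module R M]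
    [Module.Projective R M] (h : HasFreeResolution R n M) : Module.IsStablyFree R M := by
  induction n generalizing M with
  | zero =>
    obtain ⟨_, _⟩ := h
    infer_instance
  | succ n ih =>
    obtain ⟨k, f, hf, h⟩ := h
    obtain ⟨g, hg⟩ := f.exists_rightInverse_of_surjective (LinearMap.range_eq_top.mpr hf)
    have hg' : ∀ m, f (g m) = m := fun m => LinearMap.congr_fun hg m
    let p : (Fin k → R) →ₗ[R] LinearMap.ker f :=
      (LinearMap.id - g ∘ₗ f).codRestrict _ fun x => by simp [hg']
    have hp : ∀ x : LinearMap.ker f, p x = x := fun x => by ext1; simp [p]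
    have hps : Function.Surjective p := fun x => ⟨x, hp x⟩
    have : Module.Finite R (LinearMap.ker f) := .of_surjective p hps
    have : Module.Projective R (LinearMap.ker f) :=
      .of_split (LinearMap.ker f).subtype p (LinearMap.ext hp)
    have := ih h
    obtain ⟨N, _, _, _, _, _⟩ := Module.IsStablyFree.exist_free_prod R (LinearMap.ker f)
    let e : (Fin k → R) ≃ₗ[R] M × LinearMap.ker f :=
      .ofLinearMap (f.prod p) (g.coprod (LinearMap.ker f).subtype)
        (by
          ext x
          · simp [hg']
          · simp [p, hg']
          · simp
          · simp [p])
        (by ext x; simp [p])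
    have : Module.Free R (M × (LinearMap.ker f × N)) :=
      .of_equiv ((e.prodCongr (.refl R N)).trans (LinearEquiv.prodAssoc R _ _ _))
    exact .of_free_prod R M (LinearMap.ker f × N)

open IsLocalRing in
/-- If `x` is regular on `R` and on the finite module `M`, then a finite free resolution of
`M / xM` over `R / x` lifts to one of `M` over `R`. -/
lemma of_quotient {R : Type u} [CommRing R] [IsLocalRing R] [IsNoetherianRing R] {x : R}
    (hx : x ∈ maximalIdeal R) (hreg : IsSMulRegular R x) {n : ℕ} {M N : Type u} [AddCommGroup M]
    [Module R M] [Module.Finite R M] (hM : IsSMulRegular M x) [AddCommGroup N] [Module R N]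
    [Module (R ⧸ Ideal.span {x}) N] [IsScalarTower R (R ⧸ Ideal.span {x}) N] (q : M →ₗ[R] N)
    (hq : Function.Surjective q) (hker : ∀ m, q m = 0 → ∃ m', m = x • m')
    (h : HasFreeResolution (R ⧸ Ideal.span {x}) n N) : HasFreeResolution R n M := by
  have hjac : x ∈ (⊥ : Ideal R).jacobson := by
    rwa [IsLocalRing.jacobson_eq_maximalIdeal _ bot_ne_top]
  have hxN {N : Type u} [AddCommGroup N] [Module R N] [Module (R ⧸ Ideal.span {x}) N]
      [IsScalarTower R (R ⧸ Ideal.span {x}) N] (y : N) : x • y = 0 := by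
    rw [← algebraMap_smul (R ⧸ Ideal.span {x}) x y, Ideal.Quotient.algebraMap_eq,
      Ideal.Quotient.mk_singleton_self, zero_smul]
  have hkerq {M N : Type u} [AddCommGroup M] [Module R M] [AddCommGroup N] [Module R N]
      [Module (R ⧸ Ideal.span {x}) N] [IsScalarTower R (R ⧸ Ideal.span {x}) N] (q : M →ₗ[R] N)
      (hker : ∀ m, q m = 0 → ∃ m', m = x • m') :
      LinearMap.ker q = Ideal.span {x} • (⊤ : Submodule R M) := by
    ext m
    rw [Submodule.ideal_span_singleton_smul, Submodule.mem_smul_pointwise_iff_exists,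
      LinearMap.mem_ker]
    constructor
    · intro hm
      obtain ⟨m', rfl⟩ := hker m hm
      exact ⟨m', trivial, rfl⟩
    · rintro ⟨m', -, rfl⟩
      rw [map_smul, hxN]
  induction n generalizing M N with
  | zero =>
    obtain ⟨_, _⟩ := h
    have : Module.FinitePresentation R M := Module.finitePresentation_of_finite R M
    have e : QuotSMulTop x M ≃ₗ[R] N :=
      (Submodule.quotEquivOfEq _ _ (by rw [hkerq q hker, Submodule.ideal_span_singleton_smul])).trans
        (q.quotKerEquivOfSurjective hq)
    have : Module.Free (R ⧸ Ideal.span {x}) (QuotSMulTop x M) :=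
      .of_equiv (e.extendScalarsOfSurjective Ideal.Quotient.mk_surjective).symm
    exact ⟨inferInstance, (Module.free_quotSMulTop_iff_free R M hjac hM).mp this⟩
  | succ n ih =>
    obtain ⟨k, f, hf, h⟩ := h
    let r : (Fin k → R) →ₗ[R] (Fin k → R ⧸ Ideal.span {x}) :=
      LinearMap.compLeft (Algebra.linearMap R (R ⧸ Ideal.span {x})) (Fin k)
    have hr : Function.Surjective r := fun v =>
      ⟨fun i => Function.surjInv Ideal.Quotient.mk_surjective (v i), funext fun i =>
        Function.surjInv_eq Ideal.Quotient.mk_surjective (v i)⟩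
    have hrker (v : Fin k → R) (hv : r v = 0) : ∃ w, v = x • w := by
      have (i : Fin k) : ∃ c, v i = x * c :=
        Ideal.mem_span_singleton.mp (Ideal.Quotient.eq_zero_iff_mem.mp (congrFun hv i))
      choose w hw using this
      exact ⟨w, funext hw⟩
    obtain ⟨g, hg⟩ := Module.projective_lifting_property q (f.restrictScalars R ∘ₗ r) hq
    have hg' (v : Fin k → R) : q (g v) = f (r v) := LinearMap.congr_fun hg v
    have hgs : Function.Surjective g := by
      refine g.surjective_of_surjective_comp_mkQ (Ideal.span {x})
        ((Ideal.span_singleton_le_iff_mem _).mpr hjac) fun y => ?_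
      obtain ⟨m, rfl⟩ := Submodule.mkQ_surjective _ y
      obtain ⟨v, hv⟩ := (hf.comp hr) (q m)
      refine ⟨v, ?_⟩
      rw [LinearMap.comp_apply, ← sub_eq_zero, ← map_sub, Submodule.mkQ_apply,
        Submodule.Quotient.mk_eq_zero, ← hkerq q hker, LinearMap.mem_ker, map_sub, hg', sub_eq_zero]
      exact hv
    have hregk : IsSMulRegular (Fin k → R) x := IsSMulRegular.pi fun _ => hreg
    refine ⟨k, g, hgs, ?_⟩
    let q' : LinearMap.ker g →ₗ[R] LinearMap.ker f :=
      { toFun := fun v => ⟨r v, by rw [LinearMap.mem_ker, ← hg', v.2, map_zero]⟩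
        map_add' := fun v w => by ext1; simp
        map_smul' := fun c v => by ext1; simp }
    have hq's : Function.Surjective q' := by
      rintro ⟨v, hv⟩
      obtain ⟨w, rfl⟩ := hr v
      obtain ⟨m', hm'⟩ := hker (g w) ((hg' w).trans hv)
      obtain ⟨w', rfl⟩ := hgs m'
      refine ⟨⟨w - x • w', by simp [hm']⟩, Subtype.ext ?_⟩
      simp [q', hxN]
    refine ih (N := LinearMap.ker f) (fun v w h => Subtype.ext (hregk (congrArg Subtype.val h)))
      q' hq's ?_ h
    rintro ⟨v, hv⟩ hv0
    obtain ⟨w, rfl⟩ := hrker v (congrArg Subtype.val hv0)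
    refine ⟨⟨w, hM ?_⟩, rfl⟩
    simpa using hv

open IsLocalRing Pointwise in
/-- Every finite module over a regular local ring has a finite free resolution. -/
theorem exists_of_isRegularLocalRing {R : Type u} [CommRing R] [IsRegularLocalRing R] (M : Type u)
    [AddCommGroup M] [Module R M] [Module.Finite R M] : ∃ n, HasFreeResolution R n M := by
  have hR := (inferInstance : IsRegularLocalRing R).spanFinrank_maximalIdeal
  generalize hd : (maximalIdeal R).spanFinrank = d at hR
  induction d generalizing R M with
  | zero =>
    have hbot : maximalIdeal R = ⊥ :=
      (Submodule.spanFinrank_eq_zero_iff_eq_bot (maximalIdeal R).fg_of_isNoetherianRing).mp hd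
    let := (isField_iff_maximalIdeal_eq.mpr hbot).toField
    exact ⟨0, inferInstance, Module.Free.of_divisionRing R M⟩
  | succ d ih =>
    obtain ⟨x, hx, hx2, -⟩ := exists_mem_maximalIdeal_notMem_sq (A := R)
      (by rw [← hR]; exact_mod_cast d.succ_ne_zero)
    obtain ⟨hreg, hdim⟩ := IsRegularLocalRing.quotient_span_singleton hx hx2
    have hdim' : ringKrullDim (R ⧸ Ideal.span {x}) = d := by
      rw [← hR] at hdim
      push_cast at hdim
      exact le_antisymm (ENat.WithBot.add_le_add_one_right_iff.mp hdim.ge)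
        (ENat.WithBot.add_le_add_one_right_iff.mp hdim.le)
    have := IsRegularLocalRing.isDomain (A := R)
    have hx0 : x ≠ 0 := fun h => hx2 (h ▸ zero_mem _)
    have hregx : IsSMulRegular R x := fun a b h => mul_left_cancel₀ hx0 h
    obtain ⟨k, f, hf⟩ := Module.Finite.exists_fin' R M
    have hregk : IsSMulRegular (Fin k → R) x := IsSMulRegular.pi fun _ => hregx
    have : Module.Finite (R ⧸ Ideal.span {x}) (QuotSMulTop x (LinearMap.ker f)) :=
      .of_restrictScalars_finite R _ _
    obtain ⟨m, hm⟩ := ih (R := R ⧸ Ideal.span {x}) (QuotSMulTop x (LinearMap.ker f))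
      (by exact_mod_cast hreg.spanFinrank_maximalIdeal.trans hdim') hdim'.symm
    refine ⟨m + 1, k, f, hf, of_quotient hx hregx
      (fun v w h => Subtype.ext (hregk (congrArg Subtype.val h)))
      (Submodule.mkQ (x • (⊤ : Submodule R (LinearMap.ker f)))) (Submodule.mkQ_surjective _)
      (fun v hv => ?_) hm⟩
    rw [Submodule.mkQ_apply, Submodule.Quotient.mk_eq_zero,
      Submodule.mem_smul_pointwise_iff_exists] at hv
    obtain ⟨w, -, rfl⟩ := hv
    exact ⟨w, rfl⟩

/-- A finite module over a localization of a regular local ring has a finite free resolution. -/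
theorem exists_of_isLocalization {R S : Type u} [CommRing R] [IsRegularLocalRing R] [CommRing S]
    [Algebra R S] (W : Submonoid R) [IsLocalization W S] (M : Type u) [AddCommGroup M]
    [Module S M] [Module.Finite S M] : ∃ n, HasFreeResolution S n M := by
  let : Module R M := Module.compHom M (algebraMap R S)
  have : IsScalarTower R S M := .of_algebraMap_smul fun _ _ => rfl
  have : Module.Flat R S := IsLocalization.flat S W
  obtain ⟨t, ht⟩ := Module.Finite.fg_top (R := S) (M := M)
  let N : Submodule R M := Submodule.span R t
  have : Module.Finite R N := .span_finset R t
  have : IsLocalizedModule W N.subtype :=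
    { map_units := fun s => by
        rw [Module.End.isUnit_iff]
        have hu := IsLocalization.map_units S s
        have := (Module.End.isUnit_iff _).mp (hu.map (algebraMap S (Module.End S M)))
        convert this using 1
        ext m
        simp [Module.algebraMap_end_apply]
      surj := fun m => by
        obtain ⟨s, hs⟩ := multiple_mem_span_of_mem_localization_span W S (t : Set M) m
          (ht ▸ trivial)
        exact ⟨(⟨s • m, hs⟩, s), rfl⟩
      exists_of_eq := fun h => ⟨1, by rw [Subtype.ext h]⟩ }
  obtain ⟨n, hn⟩ := exists_of_isRegularLocalRing (R := R) N
  exact ⟨n, of_linearEquiv (IsLocalizedModule.isBaseChange W S N.subtype).equiv hn.baseChange⟩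

/-- The Picard group of a localization of a regular local ring is trivial. -/
theorem subsingleton_pic {R S : Type u} [CommRing R] [IsRegularLocalRing R] [CommRing S]
    [Algebra R S] (W : Submonoid R) [IsLocalization W S] : Subsingleton (CommRing.Pic S) := by
  refine CommRing.Pic.subsingleton_iff.mpr fun M _ _ _ => ?_
  obtain ⟨n, hn⟩ := exists_of_isLocalization (S := S) W M
  have := hn.isStablyFree
  exact Module.free_of_isStablyFree_of_invertible S M

end HasFreeResolution

/-- Integral extensions do not decrease the Krull dimension. -/
lemma ringKrullDim_le_of_faithfulSMul_of_isIntegral (A B : Type*) [CommRing A] [CommRing B]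
    [Algebra A B] [FaithfulSMul A B] [Algebra.IsIntegral A B] :
    ringKrullDim A ≤ ringKrullDim B := by
  refine iSup_le fun l => ?_
  obtain ⟨P, _, _⟩ := Ideal.nonempty_primesOver (S := B) l.head.asIdeal
  obtain ⟨L, hL, -⟩ := Ideal.exists_ltSeries_of_hasGoingUp l P
  exact hL ▸ Order.LTSeries.length_le_krullDim L

open IsLocalRing in
/-- Adjoining `n`-th roots of part of a regular system of parameters to a regular local ring gives
a regular local ring. -/
theorem IsRegularLocalRing.of_adjoin_roots {A B : Type*} [CommRing A] [IsRegularLocalRing A]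
    [CommRing B] [Algebra A B] [FaithfulSMul A B] {ι : Type*} [Fintype ι] (f : ι → A)
    (hf : ∀ i, f i ∈ maximalIdeal A)
    (hind : LinearIndependent (ResidueField A)
      (fun i => (maximalIdeal A).toCotangent ⟨f i, hf i⟩))
    {n : ℕ} (hn : 0 < n) (T : ι → B) (hT : ∀ i, T i ^ n = algebraMap A B (f i))
    (hgen : Algebra.adjoin A (Set.range T) = ⊤) : IsRegularLocalRing B := by
  have hint : Algebra.IsIntegral A B := by
    refine ⟨fun b => ?_⟩
    have : Algebra.adjoin A (Set.range T) ≤ integralClosure A B := by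
      refine Algebra.adjoin_le ?_
      rintro _ ⟨i, rfl⟩
      exact IsIntegral.of_pow hn (hT i ▸ isIntegral_algebraMap)
    exact this (hgen ▸ trivial)
  have : Algebra.FiniteType A B := ⟨⟨Set.finite_range T |>.toFinset, by simpa using hgen⟩⟩
  have : IsNoetherianRing B := Algebra.FiniteType.isNoetherianRing A B
  have : Nontrivial B := (FaithfulSMul.algebraMap_injective A B).nontrivial
  obtain ⟨t, ht, hspan⟩ := exists_finset_span_union_eq_maximalIdeal f hf hind
  let J : Ideal B := Ideal.span (Set.range T ∪ algebraMap A B '' t)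
  have hTJ (i : ι) : T i ∈ J := Ideal.subset_span (Or.inl ⟨i, rfl⟩)
  have hmJ : (maximalIdeal A).map (algebraMap A B) ≤ J := by
    rw [← hspan, Ideal.map_span, Ideal.span_le]
    rintro _ ⟨a, ⟨i, rfl⟩ | ha, rfl⟩
    · rw [← hT]
      exact Ideal.pow_mem_of_mem _ (hTJ i) _ hn
    · exact Ideal.subset_span (Or.inr ⟨a, ha, rfl⟩)
  have hdec (b : B) : ∃ a, b - algebraMap A B a ∈ J := by
    have hb : b ∈ Algebra.adjoin A (Set.range T) := hgen ▸ trivial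
    induction hb using Algebra.adjoin_induction with
    | mem b hb =>
      obtain ⟨i, rfl⟩ := hb
      exact ⟨0, by simpa using hTJ i⟩
    | algebraMap a => exact ⟨a, by simp⟩
    | add b c _ _ hb hc =>
      obtain ⟨a, ha⟩ := hb
      obtain ⟨a', ha'⟩ := hc
      exact ⟨a + a', by rw [map_add, add_sub_add_comm]; exact add_mem ha ha'⟩
    | mul b c _ _ hb hc =>
      obtain ⟨a, ha⟩ := hb
      obtain ⟨a', ha'⟩ := hc
      refine ⟨a * a', ?_⟩
      rw [map_mul, show b * c - algebraMap A B a * algebraMap A B a' =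
        (b - algebraMap A B a) * c + algebraMap A B a * (c - algebraMap A B a') by ring]
      exact add_mem (Ideal.mul_mem_right _ _ ha) (Ideal.mul_mem_left _ _ ha')
  have hmax (M : Ideal B) (hM : M.IsMaximal) : M = J := by
    have hcomap : M.comap (algebraMap A B) = maximalIdeal A :=
      eq_maximalIdeal (Ideal.isMaximal_comap_of_isIntegral_of_isMaximal M)
    have hJM : J ≤ M := by
      refine Ideal.span_le.mpr ?_
      rintro _ (⟨i, rfl⟩ | ⟨a, ha, rfl⟩)
      · refine hM.isPrime.mem_of_pow_mem n ?_
        rw [hT, ← Ideal.mem_comap, hcomap]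
        exact hf i
      · rw [SetLike.mem_coe, ← Ideal.mem_comap, hcomap, ← hspan]
        exact Ideal.subset_span (Or.inr ha)
    refine le_antisymm (fun b hb => ?_) hJM
    obtain ⟨a, ha⟩ := hdec b
    have ha' : algebraMap A B a ∈ M := by simpa using sub_mem hb (hJM ha)
    rw [← Ideal.mem_comap, hcomap] at ha'
    simpa using add_mem ha (hmJ (Ideal.mem_map_of_mem _ ha'))
  have : IsLocalRing B := by
    obtain ⟨M, hM⟩ := Ideal.exists_maximal B
    exact .of_unique_max_ideal ⟨M, hM, fun M' hM' => (hmax M' hM').trans (hmax M hM).symm⟩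
  refine .of_spanFinrank_maximalIdeal_le _ ?_
  have hle : (maximalIdeal B).spanFinrank ≤ (maximalIdeal A).spanFinrank := by
    rw [hmax _ (maximalIdeal.isMaximal B)]
    refine le_trans (Submodule.spanFinrank_span_le_ncard_of_finite
      ((Set.finite_range T).union (t.finite_toSet.image _))) (le_trans ?_ ht)
    refine (Set.ncard_union_le _ _).trans (add_le_add ?_ ?_)
    · rw [← Set.image_univ, ← Nat.card_eq_fintype_card, ← Set.ncard_univ]
      exact Set.ncard_image_le Set.finite_univ
    · rw [← Set.ncard_coe_finset]
      exact Set.ncard_image_le t.finite_toSet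
  calc ((maximalIdeal B).spanFinrank : WithBot ℕ∞) ≤ (maximalIdeal A).spanFinrank := by
        exact_mod_cast hle
    _ = ringKrullDim A := IsRegularLocalRing.spanFinrank_maximalIdeal
    _ ≤ ringKrullDim B := ringKrullDim_le_of_faithfulSMul_of_isIntegral A B

/-- The Kummer extension `A[T₁,…,T_r]/(Tᵢⁿ − fᵢ)` of a regular local ring is regular local. -/
theorem kummerQuot.isRegularLocalRing {A : Type*} [CommRing A] [IsRegularLocalRing A] {r : ℕ}
    (f : Fin r → A) (hf : ∀ i, f i ∈ IsLocalRing.maximalIdeal A)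
    (hind : LinearIndependent (IsLocalRing.ResidueField A)
      (fun i : Fin r => (IsLocalRing.maximalIdeal A).toCotangent ⟨f i, hf i⟩))
    {n : ℕ} (hn : 0 < n) : IsRegularLocalRing (kummerQuot f n) := by
  let T (i : Fin r) : kummerQuot f n := Ideal.Quotient.mk _ (X i)
  have hT (i : Fin r) : T i ^ n = algebraMap A (kummerQuot f n) (f i) := by
    rw [← sub_eq_zero]
    exact Ideal.Quotient.eq_zero_iff_mem.mpr (Ideal.subset_span ⟨i, rfl⟩)
  have hgen : Algebra.adjoin A (Set.range T) = ⊤ := by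
    have := congrArg (Subalgebra.map (Ideal.Quotient.mkₐ A
      (Ideal.span (Set.range fun i : Fin r => (X i : MvPolynomial (Fin r) A) ^ n - C (f i)))))
      (MvPolynomial.adjoin_range_X (R := A) (σ := Fin r))
    rwa [AlgHom.map_adjoin, ← Set.range_comp, Algebra.map_top,
      (AlgHom.range_eq_top _).mpr (Ideal.Quotient.mkₐ_surjective _ _)] at this
  have := IsRegularLocalRing.isDomain (A := A)
  let K := AlgebraicClosure (FractionRing A)
  have hinj : Function.Injective (algebraMap A K) := by
    rw [IsScalarTower.algebraMap_eq A (FractionRing A) K]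
    exact (algebraMap (FractionRing A) K).injective.comp (IsFractionRing.injective A _)
  choose t ht using fun i => IsAlgClosed.exists_pow_nat_eq (algebraMap A K (f i)) hn
  let φ : kummerQuot f n →ₐ[A] K := Ideal.Quotient.liftₐ _ (aeval t) fun p hp => by
    rw [← RingHom.mem_ker]
    revert p
    rw [← SetLike.le_def, Ideal.span_le]
    rintro _ ⟨i, rfl⟩
    simp [RingHom.mem_ker, ht]
  have : FaithfulSMul A (kummerQuot f n) := by
    refine (faithfulSMul_iff_algebraMap_injective A (kummerQuot f n)).mpr (.of_comp (f := φ) ?_)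
    convert hinj
    ext a
    exact φ.commutes a
  exact .of_adjoin_roots f hf hind hn T hT hgen

/-- Let `A` be a regular local ring (a Noetherian local ring whose maximal ideal is generated by
`dim A` elements), let `f₁,…,f_r` be elements of the maximal ideal whose images in `m/m²` are
linearly independent over the residue field, and let `n` be a positive integer invertible in `A`.
Then the Picard group of `B_n = A[T₁,…,T_r]/(Tᵢⁿ − fᵢ)[1/(T₁⋯T_r)]` is trivial:
every invertible `B_n`-module is free of rank one. -/
theorem picard_group_trivial_of_kummer_localization
    {A : Type*} [CommRing A] [IsLocalRing A] [IsNoetherianRing A]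
    (hreg : ∃ s : Finset A, Ideal.span (s : Set A) = IsLocalRing.maximalIdeal A ∧
      (s.card : WithBot (WithTop ℕ)) = ringKrullDim A)
    {r : ℕ} (f : Fin r → A) (hf : ∀ i, f i ∈ IsLocalRing.maximalIdeal A)
    (hind : LinearIndependent (IsLocalRing.ResidueField A)
      (fun i : Fin r => (IsLocalRing.maximalIdeal A).toCotangent ⟨f i, hf i⟩))
    (n : ℕ) (hn : 0 < n) (hinv : IsUnit (n : A))
    (M N : Type*) [AddCommGroup M] [Module (kummerLoc f n) M]
    [AddCommGroup N] [Module (kummerLoc f n) N]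
    (hModInv : Nonempty (TensorProduct (kummerLoc f n) M N ≃ₗ[kummerLoc f n] (kummerLoc f n))) :
    Nonempty (M ≃ₗ[kummerLoc f n] (kummerLoc f n)) := by
  have hA : IsRegularLocalRing A := by
    obtain ⟨s, hs, hcard⟩ := hreg
    refine .of_spanFinrank_maximalIdeal_le A ?_
    rw [← hcard, ← hs, ← Set.ncard_coe_finset]
    exact Nat.cast_le.mpr (Submodule.spanFinrank_span_le_ncard_of_finite s.finite_toSet)
  have := kummerQuot.isRegularLocalRing f hf hind hn
  have : Subsingleton (CommRing.Pic (kummerLoc f n)) :=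
    HasFreeResolution.subsingleton_pic (R := kummerQuot f n)
      (.powers (Ideal.Quotient.mk _ (∏ i : Fin r, (X i : MvPolynomial (Fin r) A))))
  have : Module.Invertible (kummerLoc f n) M := .left hModInv.some
  exact Module.Invertible.free_iff_linearEquiv.mp inferInstance
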